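/- A regular tree language is a path language (a finite Boolean combination of universal path languages) if and only if its syntactic algebra divides some matrix power (2,∧)^[n] of the two-element semi-lattice (2,∧). -/

import Mathlib

set_option autoImplicit false

/-! ## Trees over a ranked alphabet -/

/-- Trees over a ranked alphabet: a type `S` of letters together with an arity
function `ar : S → ℕ`; a node labelled `a` has exactly `ar a` (ordered) children. -/
inductive RTree (S : Type) (ar : S → ℕ) : Type where
  | node (a : S) (children : Fin (ar a) → RTree S ar) : RTree S ar

/-! ## Algebras -/

/-- An (unindexed) algebra structure on a carrier `α`: for every arity `n`,
a set of `n`-ary operations on `α`. -/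
structure AlgStr (α : Type) where
  ops : (n : ℕ) → Set ((Fin n → α) → α)

/-- A finite algebra: finite carrier and finitely many operations. -/
def FiniteAlg {α : Type} (A : AlgStr α) : Prop :=
  Finite α ∧ Finite ((n : ℕ) × {f : (Fin n → α) → α // f ∈ A.ops n})

/-- `h : Trees(Σ) → α` is a homomorphism into the algebra `A`:
for every letter there is an operation of `A` (of the right arity) commuting with `h`. -/
def IsHom {S : Type} {ar : S → ℕ} {α : Type} (A : AlgStr α) (h : RTree S ar → α) : Prop :=
  ∀ a : S, ∃ f ∈ A.ops (ar a), ∀ ts : Fin (ar a) → RTree S ar,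
    h (RTree.node a ts) = f (fun i => h (ts i))

/-- A tree language is recognised by an algebra if it is the preimage of a subset of
the carrier under some homomorphism into the algebra. -/
def Recognises {S : Type} {ar : S → ℕ} {α : Type} (A : AlgStr α) (L : Set (RTree S ar)) : Prop :=
  ∃ h : RTree S ar → α, IsHom A h ∧ ∃ F : Set α, L = h ⁻¹' F

/-- A tree language is regular if it is recognised by some finite algebra. -/
def TreeRegular {S : Type} {ar : S → ℕ} (L : Set (RTree S ar)) : Prop :=
  ∃ (α : Type) (A : AlgStr α), FiniteAlg A ∧ Recognises A L

/-! ## Contexts, derivatives and the syntactic congruence -/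

/-- A context: a term over `Σ` with exactly one occurrence of the hole variable. -/
inductive TCtx (S : Type) (ar : S → ℕ) : Type where
  | hole : TCtx S ar
  | node (a : S) (i : Fin (ar a)) (c : TCtx S ar)
      (other : (j : Fin (ar a)) → j ≠ i → RTree S ar) : TCtx S ar

/-- Substituting a tree for the hole of a context. -/
def TCtx.plug {S : Type} {ar : S → ℕ} : TCtx S ar → RTree S ar → RTree S ar
  | .hole, t => t
  | .node a i c other, t => RTree.node a (fun j => if h : j = i then c.plug t else other j h)

/-- `D` is a derivative of `L`: `D = {t : p[t] ∈ L}` for some context `p`. -/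
def IsDerivative {S : Type} {ar : S → ℕ} (L D : Set (RTree S ar)) : Prop :=
  ∃ p : TCtx S ar, D = {t | p.plug t ∈ L}

/-- The syntactic congruence relation of `L`: `t` and `t'` belong to exactly the same
derivatives of `L`. -/
def synRel {S : Type} {ar : S → ℕ} (L : Set (RTree S ar)) (t t' : RTree S ar) : Prop :=
  ∀ p : TCtx S ar, p.plug t ∈ L ↔ p.plug t' ∈ L

/-- The syntactic congruence of `L`, as a setoid. -/
def synSetoid {S : Type} {ar : S → ℕ} (L : Set (RTree S ar)) : Setoid (RTree S ar) :=
  ⟨synRel L, ⟨fun _ _ => Iff.rfl, fun h p => (h p).symm, fun h h' p => (h p).trans (h' p)⟩⟩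

/-- The syntactic algebra of `L`: the quotient of the tree algebra by the syntactic
congruence, with the operations induced by the tree-building operations. -/
def synAlg {S : Type} {ar : S → ℕ} (L : Set (RTree S ar)) :
    AlgStr (Quotient (synSetoid L)) where
  ops n := { g | ∃ (a : S) (h : ar a = n), ∀ us : Fin n → RTree S ar,
      g (fun i => Quotient.mk (synSetoid L) (us i))
        = Quotient.mk (synSetoid L) (RTree.node a (fun j => us (Fin.cast h j))) }

/-- The syntactic homomorphism: the quotient map onto the syntactic algebra. -/
def synMap {S : Type} {ar : S → ℕ} (L : Set (RTree S ar)) (t : RTree S ar) :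
    Quotient (synSetoid L) :=
  Quotient.mk (synSetoid L) t

/-! ## Boolean combinations -/

/-- Finite Boolean combinations of sets from a family `G`. -/
inductive BoolComb {X : Type} (G : Set (Set X)) : Set X → Prop where
  | base {s : Set X} : s ∈ G → BoolComb G s
  | compl {s : Set X} : BoolComb G s → BoolComb G sᶜ
  | union {s t : Set X} : BoolComb G s → BoolComb G t → BoolComb G (s ∪ t)
  | inter {s t : Set X} : BoolComb G s → BoolComb G t → BoolComb G (s ∩ t)

/-! ## Polynomial operations and the matrix power -/

/-- Terms built from the operations of `A`, variables (among `m` of them) and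
constants for elements of the carrier. -/
inductive PolyTerm {α : Type} (A : AlgStr α) (m : ℕ) : Type where
  | var (i : Fin m)
  | const (c : α)
  | app (n : ℕ) (f : (Fin n → α) → α) (hf : f ∈ A.ops n) (args : Fin n → PolyTerm A m)

/-- Evaluation of a polynomial term under a valuation of the variables. -/
def PolyTerm.eval {α : Type} {A : AlgStr α} {m : ℕ} : PolyTerm A m → (Fin m → α) → α
  | .var i, xs => xs i
  | .const c, _ => c
  | .app _ f _ args, xs => f (fun j => (args j).eval xs)

/-- `Pol A m`: the `m`-ary polynomial operations of `A`. -/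
def Pol {α : Type} (A : AlgStr α) (m : ℕ) : Set ((Fin m → α) → α) :=
  { g | ∃ p : PolyTerm A m, ∀ xs, g xs = p.eval xs }

/-- The algebra on the same carrier whose operations are all polynomial operations of `A`. -/
def polAlg {α : Type} (A : AlgStr α) : AlgStr α :=
  ⟨fun n => Pol A n⟩

/-- Concatenation of `k` many `n`-tuples into one `n·k`-tuple. -/
def concatTuples {α : Type} (n k : ℕ) (as : Fin k → Fin n → α) : Fin (n * k) → α :=
  fun j => as (finProdFinEquiv.symm j).2 (finProdFinEquiv.symm j).1

/-- The `n`-th matrix power of `A`: carrier `αⁿ`, and the `k`-ary operations are exactly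
those given coordinatewise by `n`-tuples of `n·k`-ary polynomial operations of `A`
applied to the concatenation of the `k` argument `n`-tuples. -/
def matrixPower {α : Type} (A : AlgStr α) (n : ℕ) : AlgStr (Fin n → α) where
  ops k := { G | ∃ fs : Fin n → ((Fin (n * k) → α) → α),
      (∀ i, fs i ∈ Pol A (n * k)) ∧
      ∀ as : Fin k → Fin n → α, G as = fun i => fs i (concatTuples n k as) }

/-! ## Division of algebras -/

/-- `A` divides `B`: `A` is (isomorphic to) a quotient of a subalgebra of a reduct
of `B`. Concretely: there is a subset of the carrier of `B` and a surjection `φ` onto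
the carrier of `A` such that every operation of `A` is induced via `φ` by some
operation of `B` under which the subset is closed. -/
def Divides {α β : Type} (A : AlgStr α) (B : AlgStr β) : Prop :=
  ∃ (C : Set β) (φ : C → α), Function.Surjective φ ∧
    ∀ n : ℕ, ∀ f ∈ A.ops n, ∃ g ∈ B.ops n,
      ∃ hcl : ∀ xs : Fin n → C, g (fun i => (xs i).1) ∈ C,
        ∀ xs : Fin n → C, φ ⟨g (fun i => (xs i).1), hcl xs⟩ = f (fun i => φ (xs i))

/-! ## Terms, tree homomorphisms and top-down transducers -/

/-- Terms over a ranked alphabet `(G, arG)` with variables from `X`. -/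
inductive TTerm (G : Type) (arG : G → ℕ) (X : Type) : Type where
  | var (x : X)
  | node (b : G) (ts : Fin (arG b) → TTerm G arG X)

/-- Substituting trees for the variables of a term. -/
def TTerm.subst {G : Type} {arG : G → ℕ} {X : Type} (σ : X → RTree G arG) :
    TTerm G arG X → RTree G arG
  | .var x => σ x
  | .node b ts => RTree.node b (fun i => (ts i).subst σ)

/-- A tree homomorphism datum: a term `t_a` over `Γ` with `ar a` variables for each `a ∈ Σ`. -/
def TreeHomData (S : Type) (arS : S → ℕ) (G : Type) (arG : G → ℕ) : Type :=
  (a : S) → TTerm G arG (Fin (arS a))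

/-- Applying a tree homomorphism: recursively replace each node labelled `a`
by the term `t_a` applied to the images of its subtrees. -/
def applyTreeHom {S : Type} {arS : S → ℕ} {G : Type} {arG : G → ℕ}
    (θ : TreeHomData S arS G arG) : RTree S arS → RTree G arG
  | .node a ts => (θ a).subst (fun i => applyTreeHom θ (ts i))

/-- A relabeling: an arity-preserving map of alphabets, lifted to trees. -/
def relabelMap {S S' : Type} {ar : S → ℕ} {ar' : S' → ℕ}
    (f : S' → S) (hf : ∀ a, ar' a = ar (f a)) : RTree S' ar' → RTree S ar
  | .node a ts => RTree.node (f a) (fun i => relabelMap f hf (ts (Fin.cast (hf a).symm i)))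

/-- A deterministic top-down tree transducer with input alphabet `(S, arS)`,
output alphabet `(G, arG)` and states `Q`. -/
structure DTOP (S : Type) (arS : S → ℕ) (G : Type) (arG : G → ℕ) (Q : Type) where
  init : Q
  δ : (a : S) → Q → TTerm G arG (Q × Fin (arS a))

/-- The semantics of a dtop, parametrised by the state it is started in. -/
def DTOP.run {S : Type} {arS : S → ℕ} {G : Type} {arG : G → ℕ} {Q : Type}
    (d : DTOP S arS G arG Q) : RTree S arS → Q → RTree G arG
  | .node a ts => fun q => (d.δ a q).subst (fun p => d.run (ts p.2) p.1)

/-! ## Path languages -/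

/-- The path alphabet `[Σ]`: leaf letters, and pairs (letter, child number). -/
def PathLetter (S : Type) (ar : S → ℕ) : Type :=
  {a : S // ar a = 0} ⊕ ((a : S) × Fin (ar a))

/-- `IsPathWord t w`: `w` is the word over `[Σ]` determined by some root-to-leaf
path of `t`. -/
inductive IsPathWord {S : Type} {ar : S → ℕ} : RTree S ar → List (PathLetter S ar) → Prop where
  | leaf (a : S) (h : ar a = 0) (ts : Fin (ar a) → RTree S ar) :
      IsPathWord (RTree.node a ts) [Sum.inl ⟨a, h⟩]
  | step (a : S) (ts : Fin (ar a) → RTree S ar) (i : Fin (ar a))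
      (w : List (PathLetter S ar)) :
      IsPathWord (ts i) w → IsPathWord (RTree.node a ts) (Sum.inr ⟨a, i⟩ :: w)

/-- A regular word language: one accepted by a DFA with finitely many states. -/
def RegularWordLang {A : Type} (W : Set (List A)) : Prop :=
  ∃ (Q : Type) (_ : Finite Q) (M : DFA A Q), ∀ w, w ∈ W ↔ w ∈ M.accepts

/-- `AW W`: the trees all of whose root-to-leaf path words belong to `W`. -/
def AW {S : Type} {ar : S → ℕ} (W : Set (List (PathLetter S ar))) : Set (RTree S ar) :=
  { t | ∀ w, IsPathWord t w → w ∈ W }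

/-- A universal path language: `AW W` for some regular word language `W`. -/
def IsUniversalPathLang {S : Type} {ar : S → ℕ} (L : Set (RTree S ar)) : Prop :=
  ∃ W : Set (List (PathLetter S ar)), RegularWordLang W ∧ L = AW W

/-- The set of path words of trees in `L`. -/
def pathWordsOf {S : Type} {ar : S → ℕ} (L : Set (RTree S ar)) :
    Set (List (PathLetter S ar)) :=
  { w | ∃ t ∈ L, IsPathWord t w }

/-! ## Some concrete algebras and the Boolean alphabet -/

/-- The two-element semi-lattice `(2, ∧)`. -/
def semilatticeAlg : AlgStr Bool where
  ops n := match n with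
    | 2 => {fun v => v 0 && v 1}
    | _ => ∅

/-- The semi-lattice with constants, `(2, ∧, 0, 1)`. -/
def semilattice01Alg : AlgStr Bool where
  ops n := match n with
    | 2 => {fun v => v 0 && v 1}
    | 0 => {fun _ => false, fun _ => true}
    | _ => ∅

/-- The two-element Boolean algebra `(2, ∨, ∧, ¬)`. -/
def boolAlg : AlgStr Bool where
  ops n := match n with
    | 2 => {fun v => v 0 || v 1, fun v => v 0 && v 1}
    | 1 => {fun v => !v 0}
    | _ => ∅

/-- The ranked alphabet `{∧, 0, 1}`. -/
inductive BLet : Type where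
  | band : BLet
  | bzero : BLet
  | bone : BLet

/-- Arities in `{∧, 0, 1}`: `∧` is binary, `0` and `1` are nullary. -/
def BLet.ar : BLet → ℕ
  | .band => 2
  | .bzero => 0
  | .bone => 0

/-- Evaluating a tree over `{∧, 0, 1}` as a Boolean formula. -/
def evalB : RTree BLet BLet.ar → Bool
  | .node .band ts => evalB (ts (0 : Fin 2)) && evalB (ts (1 : Fin 2))
  | .node .bzero _ => false
  | .node .bone _ => true

/-- The ranked alphabet whose letters are the operations of an algebra. -/
def OpsAlphabet {α : Type} (A : AlgStr α) : Type :=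
  (n : ℕ) × {f : (Fin n → α) → α // f ∈ A.ops n}

/-- Bottom-up evaluation of a tree of operations of `A` in `A`. -/
def evalOps {α : Type} (A : AlgStr α) : RTree (OpsAlphabet A) (fun g => g.1) → α
  | .node g ts => g.2.1 (fun i => evalOps A (ts i))

/-! ## Wreath products and nesting -/

/-- The wreath product `A ∘ B`. -/
def wreath {α β : Type} (A : AlgStr α) (B : AlgStr β) : AlgStr (α × β) where
  ops n := { F | ∃ f ∈ B.ops n, ∃ am : β → ((Fin n → α) → α),
      (∀ b, am b ∈ A.ops n) ∧
      ∀ xs : Fin n → α × β,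
        F xs = (am (f fun i => (xs i).2) (fun i => (xs i).1), f fun i => (xs i).2) }

/-- Annotating each node of a tree with the value of `h` on the subtree rooted there. -/
def annotate {S : Type} {ar : S → ℕ} {β : Type} (h : RTree S ar → β) :
    RTree S ar → RTree (S × β) (fun p => ar p.1)
  | .node a ts => RTree.node (a, h (RTree.node a ts)) (fun i => annotate h (ts i))

/-- `t^{L₁,…,Lₙ}`: annotate each node with the bit vector of memberships of its
subtree in the languages `Ls`. -/
noncomputable def nestAnnotate {S : Type} {ar : S → ℕ} {n : ℕ}
    (Ls : Fin n → Set (RTree S ar)) :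
    RTree S ar → RTree (S × (Fin n → Bool)) (fun p => ar p.1) :=
  annotate (fun u j => @decide (u ∈ Ls j) (Classical.propDecidable _))

/-- A class of tree languages (one family per ranked alphabet). -/
def LangClass : Type 1 :=
  ∀ (S : Type) (ar : S → ℕ), Set (Set (RTree S ar))

/-- Closure of a class of tree languages under nesting. -/
def ClosedUnderNesting (𝓛 : LangClass) : Prop :=
  ∀ (S : Type) [Finite S] (ar : S → ℕ) (n : ℕ) (Ls : Fin n → Set (RTree S ar))
    (L : Set (RTree (S × (Fin n → Bool)) (fun p => ar p.1))),
    (∀ j, Ls j ∈ 𝓛 S ar) → L ∈ 𝓛 (S × (Fin n → Bool)) (fun p => ar p.1) →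
    { t | nestAnnotate Ls t ∈ L } ∈ 𝓛 S ar

/-- The least class of algebras containing `𝒜` and closed under wreath products. -/
inductive WClosure (𝒜 : ∀ α : Type, AlgStr α → Prop) : ∀ α : Type, AlgStr α → Prop where
  | base {α : Type} {A : AlgStr α} : 𝒜 α A → WClosure 𝒜 α A
  | wreath {α β : Type} {A : AlgStr α} {B : AlgStr β} :
      WClosure 𝒜 α A → WClosure 𝒜 β B → WClosure 𝒜 (α × β) (wreath A B)

/-- The tree languages (over a fixed alphabet) recognised by algebras from a class. -/
def LangOf (𝒞 : ∀ α : Type, AlgStr α → Prop) (S : Type) (ar : S → ℕ) :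
    Set (Set (RTree S ar)) :=
  { L | ∃ (α : Type) (A : AlgStr α), 𝒞 α A ∧ Recognises A L }

/-! ## Recognition and division -/

/-- Composition of contexts. -/
def TCtx.comp {S : Type} {ar : S → ℕ} : TCtx S ar → TCtx S ar → TCtx S ar
  | .hole, q => q
  | .node a i c other, q => .node a i (c.comp q) other

theorem TCtx.plug_comp {S : Type} {ar : S → ℕ} (p q : TCtx S ar) (t : RTree S ar) :
    (p.comp q).plug t = p.plug (q.plug t) := by
  induction p with
  | hole => rfl
  | node a i c other ih => simp only [TCtx.comp, TCtx.plug, ih]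

theorem synRel_node_update {S : Type} {ar : S → ℕ} {L : Set (RTree S ar)} (a : S)
    (ts : Fin (ar a) → RTree S ar) (i : Fin (ar a)) {u : RTree S ar}
    (h : synRel L (ts i) u) :
    synRel L (RTree.node a ts) (RTree.node a (Function.update ts i u)) := by
  intro p
  have key := h (p.comp (.node a i .hole (fun j _ => ts j)))
  rw [TCtx.plug_comp, TCtx.plug_comp] at key
  convert key using 3
  · simp only [TCtx.plug]
    congr 1
    funext j
    split_ifs with hj
    · rw [hj]
    · rfl
  · simp only [TCtx.plug]
    congr 1
    funext j
    by_cases hj : j = i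
    · subst hj; simp
    · simp [hj]

theorem synRel_node {S : Type} {ar : S → ℕ} {L : Set (RTree S ar)} (a : S)
    (ts us : Fin (ar a) → RTree S ar) (h : ∀ i, synRel L (ts i) (us i)) :
    synRel L (RTree.node a ts) (RTree.node a us) := by
  classical
  have key : ∀ s : Finset (Fin (ar a)),
      synRel L (RTree.node a ts) (RTree.node a (fun i => if i ∈ s then us i else ts i)) := by
    intro s
    induction s using Finset.induction_on with
    | empty => intro p; simp
    | insert i s hi ih =>
      have step := synRel_node_update (L := L) a (fun i => if i ∈ s then us i else ts i) i
        (u := us i) (by simpa [hi] using h i)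
      have heq : Function.update (fun i => if i ∈ s then us i else ts i) i (us i)
          = fun j => if j ∈ insert i s then us j else ts j := by
        funext j
        by_cases hj : j = i
        · subst hj; simp
        · simp [hj]
      rw [heq] at step
      exact fun p => (ih p).trans (step p)
  simpa using key Finset.univ

theorem IsHom.plug_congr {S : Type} {ar : S → ℕ} {α : Type} {A : AlgStr α}
    {h : RTree S ar → α} (hh : IsHom A h) (p : TCtx S ar) {t u : RTree S ar}
    (htu : h t = h u) : h (p.plug t) = h (p.plug u) := by
  induction p with
  | hole => exact htu
  | node a i c other ih =>
    obtain ⟨f, -, hf⟩ := hh a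
    simp only [TCtx.plug, hf]
    congr 1
    funext j
    split_ifs
    · exact ih
    · rfl

theorem Recognises.divides_synAlg {S : Type} {ar : S → ℕ} {α : Type} {A : AlgStr α}
    {L : Set (RTree S ar)} (hA : Recognises A L) : Divides (synAlg L) A := by
  obtain ⟨h, hh, F, rfl⟩ := hA
  have hφ : ∀ (t : RTree S ar) (ht : h t ∈ Set.range h),
      Quotient.mk (synSetoid (h ⁻¹' F)) ht.choose = Quotient.mk (synSetoid (h ⁻¹' F)) t := by
    intro t ht
    refine Quotient.sound (s := synSetoid (h ⁻¹' F)) fun p => ?_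
    simp only [Set.mem_preimage, hh.plug_congr p ht.choose_spec]
  refine ⟨Set.range h, fun v => Quotient.mk _ v.2.choose, ?_, ?_⟩
  · intro q
    induction q using Quotient.inductionOn with
    | h t => exact ⟨⟨h t, t, rfl⟩, hφ t ⟨t, rfl⟩⟩
  · rintro n f ⟨a, rfl, hf⟩
    obtain ⟨g, hg, hgh⟩ := hh a
    have hval : ∀ xs : Fin (ar a) → Set.range h, g (fun i => (xs i).1)
        = h (RTree.node a fun i => (xs i).2.choose) := by
      intro xs
      rw [hgh]
      congr 1
      funext i
      exact (xs i).2.choose_spec.symm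
    refine ⟨g, hg, fun xs => ⟨_, (hval xs).symm⟩, fun xs => ?_⟩
    simp only [hval]
    rw [hφ _ ⟨_, rfl⟩, hf]

theorem Divides.recognises {S : Type} {ar : S → ℕ} {α : Type} {A : AlgStr α}
    {L : Set (RTree S ar)} (hA : Divides (synAlg L) A) : Recognises A L := by
  obtain ⟨C, φ, -, hφ⟩ := hA
  have hop : ∀ a : S, ∃ g ∈ A.ops (ar a), ∃ hcl : ∀ xs : Fin (ar a) → C,
      g (fun i => (xs i).1) ∈ C, ∀ (xs : Fin (ar a) → C) (us : Fin (ar a) → RTree S ar),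
        (∀ i, φ (xs i) = Quotient.mk (synSetoid L) (us i)) →
        φ ⟨g (fun i => (xs i).1), hcl xs⟩ = Quotient.mk (synSetoid L) (RTree.node a us) := by
    intro a
    let f : (Fin (ar a) → Quotient (synSetoid L)) → Quotient (synSetoid L) :=
      fun qs => Quotient.mk _ (RTree.node a fun i => (qs i).out)
    have hf : ∀ us : Fin (ar a) → RTree S ar, f (fun i => Quotient.mk (synSetoid L) (us i))
        = Quotient.mk (synSetoid L) (RTree.node a us) := fun us =>
      Quotient.sound (s := synSetoid L)
        (synRel_node a _ _ fun i => Quotient.exact (s := synSetoid L) (Quotient.out_eq _))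
    obtain ⟨g, hg, hcl, hgφ⟩ := hφ (ar a) f ⟨a, rfl, hf⟩
    refine ⟨g, hg, hcl, fun xs us hxs => ?_⟩
    rw [hgφ, ← hf]
    congr 1
    funext i
    exact hxs i
  choose g hg hcl hgφ using hop
  let H : RTree S ar → C := fun t =>
    RTree.rec (motive := fun _ => C) (fun a _ ih => ⟨g a (fun i => (ih i).1), hcl a ih⟩) t
  have hH : ∀ t, φ (H t) = Quotient.mk (synSetoid L) t := by
    intro t
    induction t with
    | node a ts ih => exact hgφ a (fun i => H (ts i)) ts ih
  refine ⟨fun t => (H t).1, fun a => ⟨g a, hg a, fun _ => rfl⟩,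
    {v | ∃ t ∈ L, (H t).1 = v}, ?_⟩
  ext t
  refine ⟨fun ht => ⟨t, ht, rfl⟩, ?_⟩
  rintro ⟨u, hu, hut⟩
  have hmk : Quotient.mk (synSetoid L) u = Quotient.mk (synSetoid L) t := by
    rw [← hH, ← hH, Subtype.ext hut]
  exact (Quotient.exact hmk TCtx.hole).1 hu

/-! ## Conjunctive maps -/

/-- A map from trees to families of propositions is conjunctive if every coordinate at a node
is the conjunction of a constant with some coordinates at the children. -/
def ConjHom {S : Type} {ar : S → ℕ} {I : Type} (h : RTree S ar → I → Prop) : Prop :=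
  ∀ a i, ∃ (c : Prop) (E : Set (Fin (ar a) × I)), ∀ ts,
    h (RTree.node a ts) i ↔ c ∧ ∀ p ∈ E, h (ts p.1) p.2

/-- Recognition by a conjunctive map with finitely many coordinates. -/
def ConjRecognisable {S : Type} {ar : S → ℕ} (L : Set (RTree S ar)) : Prop :=
  ∃ (I : Type) (_ : Finite I) (h : RTree S ar → I → Prop),
    ConjHom h ∧ ∃ F : Set (I → Prop), L = h ⁻¹' F

theorem ConjRecognisable.compl {S : Type} {ar : S → ℕ} {L : Set (RTree S ar)}
    (hL : ConjRecognisable L) : ConjRecognisable Lᶜ := by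
  obtain ⟨I, hI, h, hh, F, rfl⟩ := hL
  exact ⟨I, hI, h, hh, Fᶜ, rfl⟩

theorem ConjHom.sumElim {S : Type} {ar : S → ℕ} {I J : Type} {h : RTree S ar → I → Prop}
    {k : RTree S ar → J → Prop} (hh : ConjHom h) (hk : ConjHom k) :
    ConjHom fun t => Sum.elim (h t) (k t) := by
  rintro a (i | j)
  · obtain ⟨c, E, hE⟩ := hh a i
    exact ⟨c, Prod.map id Sum.inl '' E, fun ts => by
      rw [Set.forall_mem_image]
      exact hE ts⟩
  · obtain ⟨c, E, hE⟩ := hk a j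
    exact ⟨c, Prod.map id Sum.inr '' E, fun ts => by
      rw [Set.forall_mem_image]
      exact hE ts⟩

theorem ConjRecognisable.inter {S : Type} {ar : S → ℕ} {L M : Set (RTree S ar)}
    (hL : ConjRecognisable L) (hM : ConjRecognisable M) : ConjRecognisable (L ∩ M) := by
  obtain ⟨I, hI, h, hh, F, rfl⟩ := hL
  obtain ⟨J, hJ, k, hk, G, rfl⟩ := hM
  exact ⟨I ⊕ J, inferInstance, _, hh.sumElim hk,
    {v | (fun i => v (Sum.inl i)) ∈ F ∧ (fun j => v (Sum.inr j)) ∈ G}, rfl⟩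

theorem IsUniversalPathLang.conjRecognisable {S : Type} {ar : S → ℕ} {L : Set (RTree S ar)}
    (hL : IsUniversalPathLang L) : ConjRecognisable L := by
  obtain ⟨W, ⟨Q, hQ, M, hM⟩, rfl⟩ := hL
  refine ⟨Q, hQ, fun t q => ∀ w, IsPathWord t w → M.evalFrom q w ∈ M.accept, ?_,
    {v | v M.start}, ?_⟩
  · intro a q
    refine ⟨∀ h0 : ar a = 0, M.step q (Sum.inl ⟨a, h0⟩) ∈ M.accept,
      {p | p.2 = M.step q (Sum.inr ⟨a, p.1⟩)}, fun ts => ⟨fun h => ⟨?_, ?_⟩, ?_⟩⟩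
    · intro h0
      exact h _ (IsPathWord.leaf a h0 ts)
    · rintro ⟨i, q'⟩ hq' w hw
      obtain rfl : q' = M.step q (Sum.inr ⟨a, i⟩) := hq'
      exact h _ (IsPathWord.step a ts i w hw)
    · rintro ⟨h0, h1⟩ w hw
      cases hw with
      | leaf _ h _ => exact h0 h
      | step _ _ i w hw => exact h1 (i, M.step q (Sum.inr ⟨a, i⟩)) rfl w hw
  · ext t
    exact forall₂_congr fun w _ => hM w

theorem BoolComb.conjRecognisable {S : Type} {ar : S → ℕ} {L : Set (RTree S ar)}
    (hL : BoolComb {M : Set (RTree S ar) | IsUniversalPathLang M} L) : ConjRecognisable L := by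
  induction hL with
  | base h => exact IsUniversalPathLang.conjRecognisable h
  | compl _ ih => exact ih.compl
  | union _ _ ih₁ ih₂ =>
    rw [← compl_compl (_ ∪ _), Set.compl_union]
    exact (ih₁.compl.inter ih₂.compl).compl
  | inter _ _ ih₁ ih₂ => exact ih₁.inter ih₂

/-! ## Polynomials over the semi-lattice -/

theorem mem_pol_semilatticeAlg_iff {m : ℕ} {g : (Fin m → Bool) → Bool} :
    g ∈ Pol semilatticeAlg m ↔
      ∃ (c : Prop) (E : Set (Fin m)), ∀ xs, g xs = true ↔ c ∧ ∀ j ∈ E, xs j = true := by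
  classical
  constructor
  · rintro ⟨p, hp⟩
    simp only [hp]
    clear hp
    induction p with
    | var i => exact ⟨True, {i}, fun xs => by simp [PolyTerm.eval]⟩
    | const b => exact ⟨b = true, ∅, fun xs => by simp [PolyTerm.eval]⟩
    | app n f hf args ih =>
      match n, f, hf, args, ih with
      | 2, f, hf, args, ih =>
        obtain rfl : f = fun v => v 0 && v 1 := hf
        obtain ⟨c, E, hE⟩ := ih 0
        obtain ⟨d, E', hE'⟩ := ih 1
        refine ⟨c ∧ d, E ∪ E', fun xs => ?_⟩
        simp only [PolyTerm.eval, Bool.and_eq_true, hE, hE', Set.mem_union, or_imp, forall_and]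
        tauto
      | 0, _, hf, _, _ => exact hf.elim
      | 1, _, hf, _, _ => exact hf.elim
      | _ + 3, _, hf, _, _ => exact hf.elim
  · rintro ⟨c, E, hE⟩
    have key : ∃ p : PolyTerm semilatticeAlg m,
        ∀ xs, p.eval xs = true ↔ c ∧ ∀ j ∈ E, xs j = true := by
      clear hE
      induction E, E.toFinite using Set.Finite.induction_on with
      | empty => exact ⟨.const (decide c), fun xs => by simp [PolyTerm.eval]⟩
      | @insert j E _ _ ih =>
        obtain ⟨p, hp⟩ := ih
        refine ⟨.app 2 (fun v => v 0 && v 1) rfl ![.var j, p], fun xs => ?_⟩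
        simp only [PolyTerm.eval, Bool.and_eq_true, Matrix.cons_val_zero, Matrix.cons_val_one,
          hp, Set.forall_mem_insert]
        tauto
    obtain ⟨p, hp⟩ := key
    exact ⟨p, fun xs => Bool.eq_iff_iff.2 ((hE xs).trans (hp xs).symm)⟩

theorem ConjRecognisable.recognises {S : Type} {ar : S → ℕ} {L : Set (RTree S ar)}
    (hL : ConjRecognisable L) : ∃ n, Recognises (matrixPower semilatticeAlg n) L := by
  classical
  obtain ⟨I, hI, h, hh, F, rfl⟩ := hL
  obtain ⟨n, ⟨e⟩⟩ := Finite.exists_equiv_fin I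
  refine ⟨n, fun t i => decide (h t (e.symm i)), fun a => ?_,
    {v | (fun i => v (e i) = true) ∈ F}, ?_⟩
  · choose c E hE using hh a
    let fs : Fin n → (Fin (n * ar a) → Bool) → Bool := fun i xs =>
      decide (c (e.symm i) ∧ ∀ p ∈ E (e.symm i), xs (finProdFinEquiv (e p.2, p.1)) = true)
    refine ⟨fun as i => fs i (concatTuples n (ar a) as), ⟨fs, fun i => ?_, fun _ => rfl⟩, ?_⟩
    · refine mem_pol_semilatticeAlg_iff.2 ⟨c (e.symm i),
        (fun p => finProdFinEquiv (e p.2, p.1)) '' E (e.symm i), fun xs => ?_⟩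
      simp only [fs, decide_eq_true_eq, Set.forall_mem_image]
    · intro ts
      funext i
      simp [fs, concatTuples, hE]
  · ext t
    simp

theorem Recognises.conjRecognisable {S : Type} {ar : S → ℕ} {L : Set (RTree S ar)} {n : ℕ}
    (hL : Recognises (matrixPower semilatticeAlg n) L) : ConjRecognisable L := by
  obtain ⟨h, hh, F, rfl⟩ := hL
  refine ⟨Fin n, inferInstance, fun t i => h t i = true, fun a i => ?_,
    {v | ∃ u ∈ F, v = fun i => u i = true}, ?_⟩
  · obtain ⟨g, ⟨fs, hfs, hg⟩, hga⟩ := hh a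
    obtain ⟨c, E, hE⟩ := mem_pol_semilatticeAlg_iff.1 (hfs i)
    refine ⟨c, (fun j => ((finProdFinEquiv.symm j).2, (finProdFinEquiv.symm j).1)) '' E,
      fun ts => ?_⟩
    simp only [hga, hg]
    rw [hE, Set.forall_mem_image]
    rfl
  · ext t
    refine ⟨fun ht => ⟨_, ht, rfl⟩, ?_⟩
    rintro ⟨u, hu, hut⟩
    have : h t = u := funext fun i => Bool.eq_iff_iff.2 (congrFun hut i).to_iff
    exact Set.mem_preimage.2 (this ▸ hu)

/-! ## From conjunctive maps to path languages -/

theorem RTree.exists_isPathWord {S : Type} {ar : S → ℕ} (t : RTree S ar) :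
    ∃ w, IsPathWord t w := by
  induction t with
  | node a ts ih =>
    rcases Nat.eq_zero_or_pos (ar a) with h0 | h0
    · exact ⟨_, IsPathWord.leaf a h0 ts⟩
    · obtain ⟨w, hw⟩ := ih ⟨0, h0⟩
      exact ⟨_, IsPathWord.step a ts _ w hw⟩

open Classical in
/-- The automaton following a set of required coordinates down a path; a state `Sum.inr b`
records that the run has ended, successfully or not. -/
noncomputable def pathDFA {S : Type} {ar : S → ℕ} {I : Type} (c : S → I → Prop)
    (E : (a : S) → I → Set (Fin (ar a) × I)) (J₀ : Set I) :
    DFA (PathLetter S ar) (Set I ⊕ Bool) where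
  step q x := match q, x with
    | .inl J, .inl a => .inr (decide (∀ i ∈ J, c a.1 i))
    | .inl J, .inr ⟨a, k⟩ =>
      if ∀ i ∈ J, c a i then .inl {j | ∃ i ∈ J, (k, j) ∈ E a i} else .inr false
    | .inr _, _ => .inr false
  start := .inl J₀
  accept := {.inr true}

theorem pathDFA_evalFrom_inr_false {S : Type} {ar : S → ℕ} {I : Type} (c : S → I → Prop)
    (E : (a : S) → I → Set (Fin (ar a) × I)) (J₀ : Set I) (w : List (PathLetter S ar)) :
    (pathDFA c E J₀).evalFrom (.inr false) w = .inr false := by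
  induction w with
  | nil => rfl
  | cons x w ih =>
    rw [DFA.evalFrom_cons]
    exact ih

theorem forall_mem_iff_pathDFA {S : Type} {ar : S → ℕ} {I : Type} {h : RTree S ar → I → Prop}
    {c : S → I → Prop} {E : (a : S) → I → Set (Fin (ar a) × I)}
    (hE : ∀ a i ts, h (RTree.node a ts) i ↔ c a i ∧ ∀ p ∈ E a i, h (ts p.1) p.2)
    (J₀ : Set I) (t : RTree S ar) (J : Set I) :
    (∀ i ∈ J, h t i) ↔
      ∀ w, IsPathWord t w → (pathDFA c E J₀).evalFrom (.inl J) w = .inr true := by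
  classical
  induction t generalizing J with
  | node a ts ih =>
    by_cases hc : ∀ i ∈ J, c a i
    · have hstep : ∀ k, (pathDFA c E J₀).step (.inl J) (.inr ⟨a, k⟩)
          = .inl {j | ∃ i ∈ J, (k, j) ∈ E a i} := fun k => if_pos hc
      constructor
      · intro hJ w hw
        cases hw with
        | leaf _ h0 _ => exact congrArg Sum.inr (decide_eq_true hc)
        | step _ _ k w hw =>
          refine (congrArg ((pathDFA c E J₀).evalFrom · w) (hstep k)).trans ?_
          refine (ih k _).1 ?_ w hw
          rintro j ⟨i, hi, hj⟩
          exact ((hE a i ts).1 (hJ i hi)).2 _ hj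
      · intro hw i hi
        refine (hE a i ts).2 ⟨hc i hi, fun p hp => ?_⟩
        refine (ih p.1 {j | ∃ i ∈ J, (p.1, j) ∈ E a i}).2 (fun w hpw => ?_) p.2 ⟨i, hi, hp⟩
        exact (congrArg ((pathDFA c E J₀).evalFrom · w) (hstep p.1)).symm.trans
          (hw _ (IsPathWord.step a ts p.1 w hpw))
    · refine iff_of_false (fun hJ => hc fun i hi => ((hE a i ts).1 (hJ i hi)).1) fun hw => ?_
      obtain ⟨w, hpw⟩ := (RTree.node a ts).exists_isPathWord
      have hacc := hw w hpw
      cases hpw with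
      | leaf _ h0 _ => exact hc (of_decide_eq_true (Sum.inr_injective hacc))
      | step _ _ k w _ =>
        have hstep : (pathDFA c E J₀).step (.inl J) (.inr ⟨a, k⟩) = .inr false := if_neg hc
        have hrej := (congrArg ((pathDFA c E J₀).evalFrom · w) hstep).trans
          (pathDFA_evalFrom_inr_false c E J₀ w)
        exact Bool.false_ne_true (Sum.inr_injective (hrej.symm.trans hacc))

theorem ConjHom.isUniversalPathLang {S : Type} {ar : S → ℕ} {I : Type} [Finite I]
    {h : RTree S ar → I → Prop} (hh : ConjHom h) (J : Set I) :
    IsUniversalPathLang {t | ∀ i ∈ J, h t i} := by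
  choose c E hE using hh
  refine ⟨{w | w ∈ (pathDFA c E J).accepts},
    ⟨Set I ⊕ Bool, inferInstance, pathDFA c E J, fun _ => Iff.rfl⟩, ?_⟩
  ext t
  exact forall_mem_iff_pathDFA hE J t J

theorem BoolComb.sInter {X : Type} {G : Set (Set X)} (huniv : BoolComb G Set.univ)
    {T : Set (Set X)} (hT : T.Finite) (h : ∀ s ∈ T, BoolComb G s) : BoolComb G (⋂₀ T) := by
  induction T, hT using Set.Finite.induction_on with
  | empty => simpa using huniv
  | insert _ _ ih =>
    rw [Set.forall_mem_insert] at h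
    rw [Set.sInter_insert]
    exact h.1.inter (ih h.2)

theorem BoolComb.sUnion {X : Type} {G : Set (Set X)} (huniv : BoolComb G Set.univ)
    {T : Set (Set X)} (hT : T.Finite) (h : ∀ s ∈ T, BoolComb G s) : BoolComb G (⋃₀ T) := by
  rw [Set.sUnion_eq_compl_sInter_compl]
  exact (BoolComb.sInter huniv (hT.image _)
    (Set.forall_mem_image.2 fun s hs => (h s hs).compl)).compl

theorem ConjRecognisable.boolComb {S : Type} {ar : S → ℕ} {L : Set (RTree S ar)}
    (hL : ConjRecognisable L) : BoolComb {M : Set (RTree S ar) | IsUniversalPathLang M} L := by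
  obtain ⟨I, hI, h, hh, F, rfl⟩ := hL
  have hpath : ∀ J : Set I,
      BoolComb {M : Set (RTree S ar) | IsUniversalPathLang M} {t | ∀ i ∈ J, h t i} :=
    fun J => .base (hh.isUniversalPathLang J)
  have huniv : BoolComb {M : Set (RTree S ar) | IsUniversalPathLang M} Set.univ := by
    simpa using hpath ∅
  have hfib : ∀ v : I → Prop,
      BoolComb {M : Set (RTree S ar) | IsUniversalPathLang M} {t | h t = v} := by
    intro v
    have hcoord : ∀ i, BoolComb {M : Set (RTree S ar) | IsUniversalPathLang M}
        {t | h t i ↔ v i} := by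
      intro i
      by_cases hv : v i
      · simpa [hv] using hpath {i}
      · simpa [hv, Set.compl_ofPred] using (hpath {i}).compl
    have heq : {t | h t = v} = ⋂₀ Set.range fun i => {t | h t i ↔ v i} := by
      ext t
      simp [funext_iff]
    rw [heq]
    exact BoolComb.sInter huniv (Set.finite_range _) (Set.forall_mem_range.2 hcoord)
  have heq : h ⁻¹' F = ⋃₀ ((fun v => {t | h t = v}) '' F) := by
    ext t
    simp
  rw [heq]
  exact BoolComb.sUnion huniv (F.toFinite.image _) (Set.forall_mem_image.2 fun v _ => hfib v)

/-- A regular tree language is a path language (a finite Boolean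
combination of universal path languages) if and only if its syntactic algebra divides
some matrix power of the two-element semi-lattice `(2,∧)`. -/
theorem statement18 {S : Type} {ar : S → ℕ} [Finite S]
    (L : Set (RTree S ar)) (hL : TreeRegular L) :
    BoolComb { M : Set (RTree S ar) | IsUniversalPathLang M } L ↔
      ∃ n : ℕ, Divides (synAlg L) (matrixPower semilatticeAlg n) := by
  refine ⟨fun h => ?_, ?_⟩
  · obtain ⟨n, hn⟩ := h.conjRecognisable.recognises
    exact ⟨n, hn.divides_synAlg⟩
  · rintro ⟨n, hn⟩
    exact hn.recognises.conjRecognisable.boolComb
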